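/- Let K = GSp_{2n}(O) and suppose ι_{2n} : Sp_{2n}(O) → {±1} is the unique map making k ↦ (k, ι_{2n}(k)) a splitting of the metaplectic cover over Sp_{2n}(O). Then any map ι' : K → {±1} such that k ↦ (k, ι'(k)) is a group homomorphism splitting the cover over K must be of the form ι'(k) = η(λ(k)) ι_{2n}(k_1), where η is one of the two quadratic characters of O^*, k_1 = i(λ(k))^{-1} k, and λ is the similitude character; in particular there are exactly two such splittings. -/

import Mathlib

/-- A cocycle trivial on `i(F^*) × B` is invariant under left translation of its first argument
by `i(F^*)`. -/
lemma cocycle_mul_left {A C B : Type*} [CommGroup A] [Group C] [Group B] {i : C →* B}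
    {cc : B → B → A}
    (hcoc : ∀ g h l : B, cc g h * cc (g * h) l = cc h l * cc g (h * l))
    (hci : ∀ (a : C) (g : B), cc (i a) g = 1) (a : C) (g h : B) :
    cc (i a * g) h = cc g h := by
  simpa [hci] using hcoc (i a) g h

/-- Moving an element of `i(F^*)` across a cocycle trivial on `i(F^*) × B`. -/
lemma cocycle_mul_right {A C B : Type*} [CommGroup A] [Group C] [Group B] {i : C →* B}
    {cc : B → B → A}
    (hcoc : ∀ g h l : B, cc g h * cc (g * h) l = cc h l * cc g (h * l))
    (hci : ∀ (a : C) (g : B), cc (i a) g = 1) (b : C) (g h : B) :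
    cc g (i b * h) = cc g (i b) * cc ((i b)⁻¹ * g * i b) h := by
  have h1 := hcoc g (i b) h
  have h2 := cocycle_mul_left hcoc hci b ((i b)⁻¹ * g * i b) h
  rw [show i b * ((i b)⁻¹ * g * i b) = g * i b by group] at h2
  rw [h2, hci, one_mul] at h1
  exact h1.symm

/-- If a cocycle trivial on `i(F^*) × B` has a unique splitting over a subgroup `S` stable under
conjugation by `i(b)`, then that splitting is equivariant up to the cocycle. -/
lemma splitting_conj {C B : Type*} [Group C] [Group B] {i : C →* B} {cc : B → B → ℤˣ}
    (hcoc : ∀ g h l : B, cc g h * cc (g * h) l = cc h l * cc g (h * l))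
    (hci : ∀ (a : C) (g : B), cc (i a) g = 1) {S : Subgroup B} {ι : S → ℤˣ}
    (hι : ∀ k k' : S, ι (k * k') = ι k * ι k' * cc (k : B) (k' : B))
    (hιuniq : ∀ j : S → ℤˣ, (∀ k k', j (k * k') = j k * j k' * cc (k : B) (k' : B)) → j = ι)
    {b : C} (hS : ∀ s ∈ S, (i b)⁻¹ * s * i b ∈ S) (s : S) :
    ι ⟨(i b)⁻¹ * s * i b, hS s s.2⟩ = ι s * cc (s : B) (i b) := by
  have key : (fun s : S => ι ⟨(i b)⁻¹ * s * i b, hS s s.2⟩ * cc (s : B) (i b)) = ι := by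
    refine hιuniq _ fun k k' => ?_
    have h1 : (⟨(i b)⁻¹ * (k * k' : S) * i b, hS _ (k * k').2⟩ : S) =
        ⟨(i b)⁻¹ * k * i b, hS k k.2⟩ * ⟨(i b)⁻¹ * k' * i b, hS k' k'.2⟩ := by
      ext
      simp [mul_assoc]
    have h2 := hcoc (k : B) k' (i b)
    have h3 := cocycle_mul_right hcoc hci b (k : B) ((i b)⁻¹ * k' * i b)
    rw [show i b * ((i b)⁻¹ * (k' : B) * i b) = k' * i b by group] at h3
    rw [h3] at h2
    have h4 : cc (k * k' : B) (i b) = cc (k : B) k' * (cc (k' : B) (i b) *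
        (cc (k : B) (i b) * cc ((i b)⁻¹ * k * i b) ((i b)⁻¹ * k' * i b))) := by
      rw [← h2, ← mul_assoc, Int.units_mul_self, one_mul]
    rw [h1, hι, Subgroup.coe_mul, h4]
    have h5 := Int.units_mul_self (cc ((i b)⁻¹ * k * i b) ((i b)⁻¹ * k' * i b))
    generalize cc ((i b)⁻¹ * k * i b) ((i b)⁻¹ * k' * i b) = x at h5 ⊢
    generalize ι ⟨(i b)⁻¹ * k * i b, hS k k.2⟩ = p
    generalize ι ⟨(i b)⁻¹ * k' * i b, hS k' k'.2⟩ = q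
    calc p * q * x * (cc (k : B) k' * (cc (k' : B) (i b) * (cc (k : B) (i b) * x)))
        = p * cc (k : B) (i b) * (q * cc (k' : B) (i b)) * cc (k : B) k' * (x * x) := by
          ac_rfl
      _ = _ := by rw [h5, mul_one]
  have h := congrArg (· * cc (s : B) (i b)) (congrFun key s)
  simpa only [mul_assoc, Int.units_mul_self, mul_one] using h


/-- Splittings of the metaplectic double cover over `K = GSp_{2n}(O)`.
`B` plays the role of `GSp_{2n}(F)` with similitude character `lam`, `i(λ) = diag(I, λI)`
a section of `lam` with `c̃(i(F^*), ·) = 1`, `K` the maximal compact `GSp_{2n}(O)`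
(so `lam(K) ⊆ O^* = U`), `K ⊓ ker(lam)` is `Sp_{2n}(O)`, over which the cover splits
uniquely via `ι`.  Then every splitting `ι'` of the cover over `K` has the form
`ι'(k) = η(λ(k)) ι(k₁)` with `η` a quadratic character of `O^*` and
`k₁ = i(λ(k))⁻¹ k`; in particular there are exactly two splittings. -/
theorem stmt_15 (F : Type*) [Field F] (B : Type*) [Group B]
    (U : Subgroup Fˣ)
    (lam : B →* Fˣ) (i : Fˣ →* B) (hsec : ∀ a, lam (i a) = a)
    (cc : B → B → ℤˣ)
    -- 2-cocycle identity
    (hcoc : ∀ g h l : B, cc g h * cc (g * h) l = cc h l * cc g (h * l))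
    -- `c̃(i(F^*), GSp_{2n}(F)) = 1`
    (hci : ∀ (a : Fˣ) (g : B), cc (i a) g = 1)
    (K : Subgroup B)
    (hlamK : ∀ k ∈ K, lam k ∈ U)
    (hiU : ∀ u ∈ U, i u ∈ K)
    (hk1 : ∀ k ∈ K, (i (lam k))⁻¹ * k ∈ K ⊓ lam.ker)
    -- the unique splitting `ι` over `Sp_{2n}(O) = K ⊓ ker lam`
    (ι : ↥(K ⊓ lam.ker) → ℤˣ)
    (hι : ∀ k k' : ↥(K ⊓ lam.ker), ι (k * k') = ι k * ι k' * cc (k : B) (k' : B))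
    (hιuniq : ∀ j : ↥(K ⊓ lam.ker) → ℤˣ,
      (∀ k k', j (k * k') = j k * j k' * cc (k : B) (k' : B)) → j = ι)
    -- `O^*` has exactly two quadratic characters
    (η₀ : U →* ℤˣ) (hη₀ : η₀ ≠ 1)
    (hquad : ∀ χ : U →* ℤˣ, χ = 1 ∨ χ = η₀) :
    -- every splitting over `K` has the prescribed form
    (∀ ι' : ↥K → ℤˣ,
      (∀ k k' : ↥K, ι' (k * k') = ι' k * ι' k' * cc (k : B) (k' : B)) →
      ∃ η : U →* ℤˣ, ∀ k : ↥K,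
        ι' k = η ⟨lam (k : B), hlamK (k : B) k.2⟩ *
          ι ⟨(i (lam (k : B)))⁻¹ * (k : B), hk1 (k : B) k.2⟩) ∧
    -- and there are exactly two splittings over `K`
    (∃ f g : {j : ↥K → ℤˣ //
        ∀ k k' : ↥K, j (k * k') = j k * j k' * cc (k : B) (k' : B)},
      f ≠ g ∧ ∀ h, h = f ∨ h = g) := by
  have hform : ∀ ι' : ↥K → ℤˣ,
      (∀ k k' : ↥K, ι' (k * k') = ι' k * ι' k' * cc (k : B) (k' : B)) →
      ∃ η : U →* ℤˣ, ∀ k : ↥K,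
        ι' k = η ⟨lam (k : B), hlamK (k : B) k.2⟩ *
          ι ⟨(i (lam (k : B)))⁻¹ * (k : B), hk1 (k : B) k.2⟩ := by
    intro ι' hι'
    have hres : (fun s : ↥(K ⊓ lam.ker) => ι' ⟨s, s.2.1⟩) = ι :=
      hιuniq _ fun k k' => hι' ⟨k, k.2.1⟩ ⟨k', k'.2.1⟩
    refine ⟨MonoidHom.mk' (fun u => ι' ⟨i u, hiU u u.2⟩) fun u v => ?_, fun k => ?_⟩
    · have h := hι' ⟨i u, hiU u u.2⟩ ⟨i v, hiU v v.2⟩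
      rw [hci, mul_one] at h
      rw [← h]
      congr 1
      ext
      simp
    · have h := hι' ⟨i (lam k), hiU _ (hlamK k k.2)⟩ ⟨(i (lam k))⁻¹ * k, (hk1 k k.2).1⟩
      rw [hci, mul_one] at h
      rw [← hres]
      refine Eq.trans ?_ h
      congr 1
      ext
      simp
  let twist : (U →* ℤˣ) → ↥K → ℤˣ := fun η k => η ⟨lam (k : B), hlamK (k : B) k.2⟩ *
    ι ⟨(i (lam (k : B)))⁻¹ * (k : B), hk1 (k : B) k.2⟩
  have hsplit : ∀ (η : U →* ℤˣ) (k k' : ↥K),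
      twist η (k * k') = twist η k * twist η k' * cc (k : B) (k' : B) := by
    intro η k k'
    have hib : i (lam k') ∈ K := hiU _ (hlamK k' k'.2)
    have hS : ∀ s ∈ K ⊓ lam.ker, (i (lam k'))⁻¹ * s * i (lam k') ∈ K ⊓ lam.ker := by
      intro s hs
      refine ⟨K.mul_mem (K.mul_mem (K.inv_mem hib) hs.1) hib, ?_⟩
      have hs2 : lam s = 1 := hs.2
      simp [hs2]
    have hη : η ⟨lam ((k * k' : ↥K) : B), hlamK _ (k * k').2⟩ =
        η ⟨lam (k : B), hlamK (k : B) k.2⟩ * η ⟨lam (k' : B), hlamK (k' : B) k'.2⟩ := by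
      rw [← map_mul]
      congr 1
      ext
      simp
    have hprod : (⟨(i (lam ((k * k' : ↥K) : B)))⁻¹ * ((k * k' : ↥K) : B),
          hk1 _ (k * k').2⟩ : ↥(K ⊓ lam.ker)) =
        ⟨(i (lam k'))⁻¹ * ((i (lam k))⁻¹ * k) * i (lam k'), hS _ (hk1 k k.2)⟩ *
          ⟨(i (lam k'))⁻¹ * k', hk1 k' k'.2⟩ := by
      ext
      simp [mul_assoc]
    have hconj := splitting_conj hcoc hci hι hιuniq hS ⟨(i (lam k))⁻¹ * k, hk1 k k.2⟩
    have hcc : cc (k : B) k' = cc ((i (lam k))⁻¹ * k) (i (lam k')) *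
        cc ((i (lam k'))⁻¹ * ((i (lam k))⁻¹ * k) * i (lam k')) ((i (lam k'))⁻¹ * k') := by
      rw [← cocycle_mul_right hcoc hci, mul_inv_cancel_left,
        ← cocycle_mul_left hcoc hci (lam k) ((i (lam k))⁻¹ * k), mul_inv_cancel_left]
    simp only [twist]
    rw [hη, hprod, hι, hconj, hcc]
    ac_rfl
  refine ⟨hform, ⟨twist 1, hsplit 1⟩, ⟨twist η₀, hsplit η₀⟩, fun heq => hη₀ ?_, fun h => ?_⟩
  · ext1 u
    have h := congrFun (congrArg Subtype.val heq) ⟨i u, hiU u u.2⟩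
    simp only [twist, mul_left_inj, hsec] at h
    exact h.symm
  · obtain ⟨η, hη⟩ := hform h.1 h.2
    rcases hquad η with rfl | rfl
    · exact Or.inl (Subtype.ext (funext hη))
    · exact Or.inr (Subtype.ext (funext hη))
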